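/- arXiv:1811.10539 — 5 statements merged into one kernel-verified Lean document; each statement's English description precedes it below -/
import Mathlib

section
/- Let F be a field with char(F) ≠ 2, m ≥ 1, and J ∈ GL_m(F) a symmetric invertible matrix. Let T ∈ M_m(F) be self-adjoint with respect to J and regular, with characteristic polynomial f, and set L = F[x]/(f). Then for every u ∈ L one has det(u(T)) = N_{L/F}(u), where N_{L/F} is the algebra norm (the determinant of multiplication by u on L), and consequently the map u ↦ u(T) restricts to a group isomorphism from {u ∈ L : u² = 1 and N_{L/F}(u) = 1} onto the stabilizer of T in the special orthogonal group: {g ∈ M_m(F) : gᵀ J g = J, det g = 1, and g T = T g}. -/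
open Matrix

open Polynomial

namespace Matrix

variable {F n : Type*} [Field F] [Fintype n] [DecidableEq n]

/-- A regular matrix has a cyclic vector. -/
theorem exists_charpoly_dvd_of_aeval_mulVec_eq_zero {T : Matrix n n F}
    (hT : minpoly F T = T.charpoly) :
    ∃ v : n → F, ∀ p : F[X], aeval T p *ᵥ v = 0 → T.charpoly ∣ p := by
  obtain ⟨w, hw⟩ := Module.exists_ker_toSpanSingleton_eq_annihilator F[X]
    (Module.AEval' (toLin' T))
  obtain ⟨v, rfl⟩ := (Module.AEval'.of _).surjective w
  refine ⟨v, fun p hp => ?_⟩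
  rw [← span_minpoly_eq_annihilator, minpoly_toLin', hT] at hw
  rw [← Ideal.mem_span_singleton, ← hw, LinearMap.mem_ker, LinearMap.toSpanSingleton_apply,
    ← Module.AEval.of_aeval_smul, LinearEquiv.map_eq_zero_iff, Module.End.smul_def, ← hp,
    ← toLin'_apply]
  congr 1
  exact aeval_algHom_apply (toLinAlgEquiv' : Matrix n n F ≃ₐ[F] _) T p

theorem _root_.Commute.aeval_right {R A : Type*} [CommSemiring R] [Semiring A] [Algebra R A]
    {a b : A} (h : Commute a b) (p : R[X]) : Commute a (aeval b p) := by
  induction p using Polynomial.induction_on' with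
  | add p q hp hq => simpa using hp.add_right hq
  | monomial k c =>
    rw [aeval_monomial]
    exact (Algebra.commute_algebraMap_right c a).mul_right (h.pow_right k)

/-- Transposition intertwines with a Gram matrix in the polynomials of a self-adjoint matrix. -/
theorem transpose_aeval_mul_of_transpose_mul {J T : Matrix n n F} (hT : Tᵀ * J = J * T)
    (p : F[X]) : (aeval T p)ᵀ * J = J * aeval T p := by
  induction p using Polynomial.induction_on with
  | C a => simp [Algebra.algebraMap_eq_smul_one]
  | add p q hp hq => simp only [map_add, transpose_add, add_mul, mul_add, hp, hq]
  | monomial k a h =>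
    rw [pow_succ, ← mul_assoc, map_mul, aeval_X, transpose_mul, mul_assoc, h, ← mul_assoc, hT,
      mul_assoc, ((Commute.refl T).aeval_right _).eq]

section charpolyQuotient

variable (T : Matrix n n F)

/-- Evaluation at `T` on the quotient of the polynomial ring by the characteristic polynomial. -/
noncomputable def evalCharpolyQuotient : (F[X] ⧸ Ideal.span {T.charpoly}) →ₐ[F] Matrix n n F :=
  Ideal.Quotient.liftₐ _ (aeval T) fun p hp => by
    obtain ⟨q, rfl⟩ := Ideal.mem_span_singleton.1 hp
    rw [map_mul, aeval_self_charpoly, zero_mul]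

@[simp]
theorem evalCharpolyQuotient_mk (p : F[X]) :
    evalCharpolyQuotient T (Ideal.Quotient.mk _ p) = aeval T p :=
  rfl

variable {T}

/-- Acting on a cyclic vector identifies the quotient by the characteristic polynomial of a
regular matrix with the space the matrix acts on. -/
theorem exists_linearEquiv_evalCharpolyQuotient_mulVec (hT : minpoly F T = T.charpoly) :
    ∃ (v : n → F) (e : (F[X] ⧸ Ideal.span {T.charpoly}) ≃ₗ[F] (n → F)),
      ∀ u, e u = evalCharpolyQuotient T u *ᵥ v := by
  obtain ⟨v, hv⟩ := exists_charpoly_dvd_of_aeval_mulVec_eq_zero hT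
  let f : (F[X] ⧸ Ideal.span {T.charpoly}) →ₗ[F] (n → F) :=
    (mulVecBilin F F).flip v ∘ₗ (evalCharpolyQuotient T).toLinearMap
  have hf : Function.Injective f := by
    rw [injective_iff_map_eq_zero]
    intro u hu
    obtain ⟨p, rfl⟩ := Ideal.Quotient.mk_surjective u
    exact Ideal.Quotient.eq_zero_iff_mem.2 (Ideal.mem_span_singleton.2 (hv p hu))
  have : FiniteDimensional F (F[X] ⧸ Ideal.span {T.charpoly}) :=
    T.charpoly_monic.finite_adjoinRoot
  have hd : Module.finrank F (F[X] ⧸ Ideal.span {T.charpoly}) = Module.finrank F (n → F) := by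
    rw [finrank_quotient_span_eq_natDegree, charpoly_natDegree_eq_dim, Module.finrank_pi]
  exact ⟨v, LinearEquiv.ofInjectiveOfFinrankEq f hf hd, fun u => rfl⟩

theorem evalCharpolyQuotient_injective (hT : minpoly F T = T.charpoly) :
    Function.Injective (evalCharpolyQuotient T) := by
  obtain ⟨v, e, he⟩ := exists_linearEquiv_evalCharpolyQuotient_mulVec hT
  intro a b hab
  apply e.injective
  rw [he, he, hab]

theorem det_evalCharpolyQuotient (hT : minpoly F T = T.charpoly)
    (u : F[X] ⧸ Ideal.span {T.charpoly}) :
    (evalCharpolyQuotient T u).det = Algebra.norm F u := by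
  obtain ⟨v, e, he⟩ := exists_linearEquiv_evalCharpolyQuotient_mulVec hT
  rw [Algebra.norm_apply, ← LinearMap.det_conj _ e, ← LinearMap.det_toLin']
  congr 1
  refine LinearMap.ext fun x => ?_
  obtain ⟨w, rfl⟩ := e.surjective x
  simp only [LinearMap.comp_apply, LinearEquiv.coe_coe, LinearEquiv.symm_apply_apply]
  simp [he, mulVec_mulVec]

/-- The commutant of a regular matrix consists of its polynomials. -/
theorem exists_evalCharpolyQuotient_eq_of_commute (hT : minpoly F T = T.charpoly)
    {g : Matrix n n F} (hg : Commute g T) : ∃ u, evalCharpolyQuotient T u = g := by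
  obtain ⟨v, e, he⟩ := exists_linearEquiv_evalCharpolyQuotient_mulVec hT
  have hcomm (w) : Commute g (evalCharpolyQuotient T w) := by
    obtain ⟨p, rfl⟩ := Ideal.Quotient.mk_surjective w
    exact hg.aeval_right p
  obtain ⟨u, hu⟩ := e.surjective (g *ᵥ v)
  refine ⟨u, toLin'.injective (LinearMap.ext fun x => ?_)⟩
  obtain ⟨w, rfl⟩ := e.surjective x
  rw [toLin'_apply, toLin'_apply, he, mulVec_mulVec, mulVec_mulVec, (hcomm w).eq, ← map_mul,
    mul_comm, map_mul, ← mulVec_mulVec, ← mulVec_mulVec, ← hu, he]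

theorem transpose_evalCharpolyQuotient_mul {J : Matrix n n F} (hT : Tᵀ * J = J * T)
    (u : F[X] ⧸ Ideal.span {T.charpoly}) :
    (evalCharpolyQuotient T u)ᵀ * J = J * evalCharpolyQuotient T u := by
  obtain ⟨p, rfl⟩ := Ideal.Quotient.mk_surjective u
  exact transpose_aeval_mul_of_transpose_mul hT p

theorem transpose_evalCharpolyQuotient_mul_mul_eq_iff {J : Matrix n n F} (hJ : IsUnit J)
    (hT : Tᵀ * J = J * T) (hreg : minpoly F T = T.charpoly)
    (u : F[X] ⧸ Ideal.span {T.charpoly}) :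
    (evalCharpolyQuotient T u)ᵀ * J * evalCharpolyQuotient T u = J ↔ u ^ 2 = 1 := by
  rw [transpose_evalCharpolyQuotient_mul hT, mul_assoc, hJ.mul_eq_left, ← map_mul, ← sq,
    ← map_one (evalCharpolyQuotient T), (evalCharpolyQuotient_injective hreg).eq_iff]

end charpolyQuotient

end Matrix

/-- **Stabilizer of a regular self-adjoint element in the special orthogonal
group.**
Let `F` be a field of characteristic `≠ 2`, `m ≥ 1`, `J` a symmetric
invertible `m × m` matrix, `T` a regular self-adjoint matrix with
characteristic polynomial `f`, and `L = F[x]/(f)`. Then for the map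
`φ : L → M_m(F)` induced by evaluation at `T` one has
`det (φ u) = N_{L/F}(u)` for all `u ∈ L`, and `φ` restricts to a group
isomorphism (an injection with multiplicative structure inherited from the
algebra map) from `{u : L | u ^ 2 = 1 ∧ N_{L/F}(u) = 1}` onto the stabilizer
`{g | gᵀ * J * g = J ∧ det g = 1 ∧ g * T = T * g}` of `T` in `SO(J)(F)`. -/
theorem stabilizer_eq_mu2_norm_one
    (F : Type) [Field F] (hF : ringChar F ≠ 2) (m : ℕ) (hm : 1 ≤ m)
    (J : Matrix (Fin m) (Fin m) F) (hJsymm : Jᵀ = J) (hJ : IsUnit J)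
    (T : Matrix (Fin m) (Fin m) F)
    (hT : J⁻¹ * Tᵀ * J = T) (hTreg : minpoly F T = T.charpoly) :
    ∃ φ : (Polynomial F ⧸ Ideal.span {T.charpoly}) →ₐ[F] Matrix (Fin m) (Fin m) F,
      (∀ p : Polynomial F,
        φ (Ideal.Quotient.mk (Ideal.span {T.charpoly}) p) = Polynomial.aeval T p) ∧
      (∀ u : Polynomial F ⧸ Ideal.span {T.charpoly},
        (φ u).det = Algebra.norm F u) ∧
      Set.InjOn φ {u | u ^ 2 = 1 ∧ Algebra.norm F u = 1} ∧
      φ '' {u | u ^ 2 = 1 ∧ Algebra.norm F u = 1}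
        = {g | gᵀ * J * g = J ∧ g.det = 1 ∧ g * T = T * g} := by
  have hTJ : Tᵀ * J = J * T := by
    have hdet := (isUnit_iff_isUnit_det J).1 hJ
    rw [← mul_nonsing_inv_cancel_left J (Tᵀ * J) hdet, ← mul_assoc J⁻¹, hT]
  refine ⟨evalCharpolyQuotient T, evalCharpolyQuotient_mk T, det_evalCharpolyQuotient hTreg,
    (evalCharpolyQuotient_injective hTreg).injOn, Set.ext fun g => ⟨?_, ?_⟩⟩
  · rintro ⟨u, ⟨hu, hN⟩, rfl⟩
    refine ⟨(transpose_evalCharpolyQuotient_mul_mul_eq_iff hJ hTJ hTreg u).2 hu,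
      (det_evalCharpolyQuotient hTreg u).trans hN, ?_⟩
    simpa using ((Commute.all u (Ideal.Quotient.mk _ X)).map (evalCharpolyQuotient T)).eq
  · rintro ⟨hg, hdet, hc⟩
    obtain ⟨u, rfl⟩ := exists_evalCharpolyQuotient_eq_of_commute hTreg hc
    exact ⟨u, ⟨(transpose_evalCharpolyQuotient_mul_mul_eq_iff hJ hTJ hTreg u).1 hg,
      (det_evalCharpolyQuotient hTreg u).symm.trans hdet⟩, rfl⟩
end

section
/- Let k be an infinite field with char(k) ≠ 2, m ≥ 1, and J ∈ GL_m(k) a symmetric invertible matrix. Let T ∈ M_m(k) be self-adjoint with respect to J. Then the stabilizer {g ∈ M_m(k) : gᵀ J g = J and g T = T g} of T in the orthogonal group O(J)(k) is a finite set if and only if the minimal polynomial of T equals its characteristic polynomial. -/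
open Matrix

section CyclicModule

open Polynomial LinearMap

variable {k M : Type*} [Field k] [AddCommGroup M] [Module k M] [Module k[X] M]
  [IsScalarTower k k[X] M]

theorem finrank_range_toSpanSingleton_eq_natDegree {f : k[X]} {v : M}
    (hv : ker (toSpanSingleton k[X] M v) = Ideal.span {f}) :
    Module.finrank k (range (toSpanSingleton k[X] M v)) = f.natDegree := by
  rw [← finrank_quotient_span_eq_natDegree (f := f)]
  exact LinearEquiv.finrank_eq (((Submodule.quotEquivOfEq _ _ hv.symm).trans
    (quotKerEquivRange _)).restrictScalars k).symm

/-- The linear functional reading off the top coefficient of the representative modulo `f`. -/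
theorem exists_dual_smul_eq_coeff_modByMonic {f : k[X]} (hf : f.Monic) {v : M}
    (hv : ker (toSpanSingleton k[X] M v) = Ideal.span {f}) (n : ℕ) :
    ∃ l : M →ₗ[k] k, ∀ p : k[X], l (p • v) = (p %ₘ f).coeff n := by
  have h : lcoeff k n ∘ₗ Polynomial.modByMonicHom f ∈
      range ((toSpanSingleton k[X] M v).restrictScalars k).dualMap := by
    rw [range_dualMap_eq_dualAnnihilator_ker, Submodule.mem_dualAnnihilator]
    intro p hp
    have hp' : p ∈ ker (toSpanSingleton k[X] M v) := hp
    rw [hv, Ideal.mem_span_singleton, ← modByMonic_eq_zero_iff_dvd hf] at hp'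
    simp [Polynomial.modByMonicHom, hp']
  obtain ⟨l, hl⟩ := h
  exact ⟨l, fun p ↦ LinearMap.congr_fun hl p⟩

theorem exists_isCompl_range_toSpanSingleton [Module.Finite k M] {f : k[X]} (hf : f.Monic)
    (hann : Module.annihilator k[X] M = Ideal.span {f}) {v : M}
    (hv : ker (toSpanSingleton k[X] M v) = Ideal.span {f}) :
    ∃ N : Submodule k[X] M, IsCompl (range (toSpanSingleton k[X] M v)) N := by
  set W := range (toSpanSingleton k[X] M v)
  obtain ⟨l, hl⟩ := exists_dual_smul_eq_coeff_modByMonic hf hv (f.natDegree - 1)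
  have hmod (p : k[X]) (u : M) : (p %ₘ f) • u = p • u := by
    have h0 : f • u = 0 := Module.mem_annihilator.mp
      (hann ▸ Ideal.mem_span_singleton_self f) u
    conv_rhs => rw [← modByMonic_add_div p f, add_smul, mul_comm, mul_smul, h0]
    simp
  let N : Submodule k[X] M :=
    { carrier := {u | ∀ q : k[X], l (q • u) = 0}
      add_mem' := fun ha hb q ↦ by simp [smul_add, ha q, hb q]
      zero_mem' := fun q ↦ by simp
      smul_mem' := fun c u hu q ↦ by rw [smul_smul]; exact hu _ }
  let Φ : M →ₗ[k] (Fin f.natDegree → k) := LinearMap.pi fun i ↦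
    l ∘ₗ (LinearMap.lsmul k[X] M (X ^ (i : ℕ))).restrictScalars k
  have hΦ (u : M) (i) : Φ u i = l ((X ^ (i : ℕ) : k[X]) • u) := rfl
  have hker (u : M) (hu : Φ u = 0) : u ∈ N := by
    intro q
    rw [← hmod, as_sum_range' (q %ₘ f) (f.natDegree + 1)
      ((natDegree_modByMonic_le q hf).trans_lt (Nat.lt_succ_self _)), Finset.sum_smul, map_sum]
    refine Finset.sum_eq_zero fun i _ ↦ ?_
    rw [← C_mul_X_pow_eq_monomial, ← smul_eq_C_mul, smul_assoc, map_smul]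
    by_cases hi : i < f.natDegree
    · rw [← hΦ u ⟨i, hi⟩, hu]; simp
    · rw [coeff_eq_zero_of_degree_lt, zero_smul]
      refine (degree_modByMonic_lt q hf).trans_le ?_
      rw [degree_eq_natDegree hf.ne_zero]
      exact_mod_cast not_lt.mp hi
  have hinj (w : M) (hw : w ∈ W) (h0 : Φ w = 0) : w = 0 := by
    obtain ⟨p, rfl⟩ := hw
    rw [toSpanSingleton_apply] at h0 ⊢
    rw [← hmod] at h0 ⊢
    set r := p %ₘ f with hr
    by_contra hne
    have hr0 : r ≠ 0 := fun h ↦ hne (by rw [h, zero_smul])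
    have hdeg : r.natDegree < f.natDegree :=
      natDegree_lt_natDegree hr0 (degree_modByMonic_lt p hf)
    have h1 := congr_fun h0 ⟨f.natDegree - 1 - r.natDegree, by omega⟩
    rw [hΦ, smul_smul, hl, (modByMonic_eq_self_iff hf).mpr] at h1
    · simp only [Pi.zero_apply] at h1
      rw [show f.natDegree - 1 = r.natDegree + (f.natDegree - 1 - r.natDegree) by omega] at h1
      simp only [show r.natDegree + (f.natDegree - 1 - r.natDegree) - r.natDegree =
        f.natDegree - 1 - r.natDegree by omega, coeff_X_pow_mul] at h1
      exact hr0 (leadingCoeff_eq_zero.mp h1)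
    · apply degree_lt_degree
      rw [natDegree_X_pow_mul _ hr0]
      simp only
      omega
  have hsurj : Function.Surjective (Φ ∘ₗ (W.subtype).restrictScalars k) := by
    have : FiniteDimensional k W :=
      inferInstanceAs (FiniteDimensional k (W.restrictScalars k))
    rw [← injective_iff_surjective_of_finrank_eq_finrank]
    · rw [← ker_eq_bot, ker_eq_bot']
      exact fun w hw ↦ Subtype.ext (hinj w w.2 hw)
    · rw [Module.finrank_fin_fun]
      exact finrank_range_toSpanSingleton_eq_natDegree hv
  refine ⟨N, IsCompl.of_eq ?_ ?_⟩
  · rw [eq_bot_iff]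
    rintro w ⟨hw, hwN⟩
    exact hinj w hw (funext fun i ↦ hwN _)
  · rw [eq_top_iff]
    intro u _
    obtain ⟨w, hw⟩ := hsurj (Φ u)
    have : u - w ∈ N := hker _ (by rw [map_sub, ← hw]; simp)
    exact Submodule.mem_sup.mpr ⟨w, w.2, u - w, this, by simp⟩

theorem range_toSpanSingleton_eq_top_of_commute [Module.Finite k M] {f : k[X]} (hf : f.Monic)
    (hann : Module.annihilator k[X] M = Ideal.span {f}) {v : M}
    (hv : ker (toSpanSingleton k[X] M v) = Ideal.span {f})
    (hcomm : ∀ φ ψ : Module.End k[X] M, Commute φ ψ) :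
    range (toSpanSingleton k[X] M v) = ⊤ := by
  obtain ⟨N, hN⟩ := exists_isCompl_range_toSpanSingleton hf hann hv
  suffices h : N = ⊥ by simpa [h] using hN.sup_eq_top
  rw [eq_bot_iff]
  intro w hw
  have hle : ker (toSpanSingleton k[X] M v) ≤ ker (toSpanSingleton k[X] M w) := by
    rw [hv, ← hann]
    exact fun p hp ↦ Module.mem_annihilator.mp hp w
  have hvW : v ∈ range (toSpanSingleton k[X] M v) := ⟨1, by simp⟩
  obtain ⟨π, hπ⟩ : ∃ π : Module.End k[X] M, π = Submodule.projection _ N hN := ⟨_, rfl⟩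
  obtain ⟨ψ, hψ⟩ : ∃ ψ : Module.End k[X] M, ψ =
    (ker (toSpanSingleton k[X] M v)).liftQ _ hle ∘ₗ
      (quotKerEquivRange (toSpanSingleton k[X] M v)).symm.toLinearMap ∘ₗ
      Submodule.projectionOnto _ N hN := ⟨_, rfl⟩
  have hπv : π v = v := hπ ▸ Submodule.projection_apply_of_mem_left hN hvW
  have hψv : ψ v = w := by
    have h1 : (quotKerEquivRange (toSpanSingleton k[X] M v)).symm ⟨v, hvW⟩ =
        Submodule.Quotient.mk 1 := by
      rw [LinearEquiv.symm_apply_eq]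
      exact Subtype.ext ((quotKerEquivRange_apply_mk _ _).trans (by simp)).symm
    rw [hψ, LinearMap.comp_apply, LinearMap.comp_apply,
      Submodule.projectionOnto_apply_of_mem_left hN hvW, LinearEquiv.coe_coe, h1,
      Submodule.liftQ_apply, toSpanSingleton_apply, one_smul]
  have hπw : π w = 0 := by
    rw [hπ, Submodule.projection_apply, (Submodule.projectionOnto_apply_eq_zero_iff hN).mpr hw,
      Submodule.coe_zero]
  have h := LinearMap.congr_fun (hcomm ψ π) v
  rw [Module.End.mul_apply, Module.End.mul_apply, hπv, hψv, hπw] at h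
  exact h

end CyclicModule

theorem finite_setOf_mul_self_eq_one {R : Type*} [CommRing R] [IsArtinianRing R]
    (h2 : IsUnit (2 : R)) : {x : R | x * x = 1}.Finite := by
  refine Set.Finite.of_injOn (f := fun x ↦ {P : PrimeSpectrum R | x - 1 ∈ P.asIdeal})
    (t := Set.univ) (fun _ _ ↦ Set.mem_univ _) ?_ Set.finite_univ
  intro x hx y hy hxy
  simp only [Set.mem_ofPred_eq] at hx hy
  have hnil : IsNilpotent (x - y) := by
    rw [← mem_nilradical, nilradical_eq_sInf, Ideal.mem_sInf]
    intro P hP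
    have hPp : P.IsPrime := hP
    have hiff : x - 1 ∈ P ↔ y - 1 ∈ P := Set.ext_iff.mp hxy ⟨P, hPp⟩
    by_cases h : x - 1 ∈ P
    · simpa using P.sub_mem h (hiff.mp h)
    · have hx' : (x - 1) * (x + 1) ∈ P := by
        rw [show (x - 1) * (x + 1) = 0 by linear_combination hx]; exact P.zero_mem
      have hy' : (y - 1) * (y + 1) ∈ P := by
        rw [show (y - 1) * (y + 1) = 0 by linear_combination hy]; exact P.zero_mem
      simpa using P.sub_mem ((hPp.mem_or_mem hx').resolve_left h)
        ((hPp.mem_or_mem hy').resolve_left (hiff.not.mp h))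
  have hunit : IsUnit (x + y) := by
    have h2x : IsUnit (2 * x) := h2.mul (IsUnit.of_mul_eq_one x hx)
    rw [show x + y = 2 * x + -(x - y) by ring]
    exact hnil.neg.isUnit_add_left_of_commute h2x (Commute.all _ _)
  rw [← sub_eq_zero]
  exact hunit.mul_left_eq_zero.mp (by linear_combination hx - hy)

theorem infinite_isometry_commute_of_skew {k n : Type*} [Field k] [Infinite k] [Fintype n]
    [DecidableEq n] (h2 : (2 : k) ≠ 0) {J T s : Matrix n n k} (hs : sᵀ * J = -(J * s))
    (hsT : s * T = T * s) (hs0 : s ≠ 0) :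
    {g : Matrix n n k | gᵀ * J * g = J ∧ g * T = T * g}.Infinite := by
  have hdet (c : k) (hc : ¬ (-s).charpoly.IsRoot c) : IsUnit (scalar n c + s).det := by
    rw [isUnit_iff_ne_zero]
    rwa [Polynomial.IsRoot, eval_charpoly, sub_neg_eq_add] at hc
  have hinf : {c : k | (-s).charpoly.IsRoot c}ᶜ.Infinite :=
    (Polynomial.finite_setOfPred_isRoot (charpoly_monic _).ne_zero).infinite_compl
  refine Set.infinite_of_injOn_mapsTo
    (f := fun c : k ↦ (scalar n c - s) * (scalar n c + s)⁻¹) ?_ ?_ hinf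
  · intro c hc d hd hcd
    have hc1 := nonsing_inv_mul _ (hdet c hc)
    have hd1 := nonsing_inv_mul _ (hdet d hd)
    set g := (scalar n c - s) * (scalar n c + s)⁻¹ with hg
    have hcg : g * (scalar n c + s) = scalar n c - s := by rw [hg, mul_assoc, hc1, mul_one]
    have hdg : g * (scalar n d + s) = scalar n d - s := by
      rw [show g = (scalar n d - s) * (scalar n d + s)⁻¹ from hcd, mul_assoc, hd1, mul_one]
    have hsub : (c - d) • (g - 1) = 0 := by
      have : g * (scalar n c + s) - g * (scalar n d + s) =
        (scalar n c - s) - (scalar n d - s) := by rw [hcg, hdg]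
      have h3 : g * (scalar n (c - d)) = scalar n (c - d) := by
        rw [map_sub, mul_sub]
        simpa [mul_add] using this
      have h4 : scalar n (c - d) = (c - d) • (1 : Matrix n n k) := by
        rw [smul_one_eq_diagonal, scalar_apply]
      rw [h4, mul_smul_comm, mul_one] at h3
      rw [smul_sub, h3, sub_self]
    rcases smul_eq_zero.mp hsub with h | h
    · exact sub_eq_zero.mp h
    · rw [sub_eq_zero.mp h, one_mul] at hcg
      refine absurd ?_ hs0
      have : (2 : k) • s = 0 := by
        rw [two_smul, show s + s = (scalar n c + s) - (scalar n c - s) by abel, hcg, sub_self]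
      exact (smul_eq_zero.mp this).resolve_left h2
  · intro c hc
    have hu := hdet c hc
    have h1 := nonsing_inv_mul _ hu
    have h1' := mul_nonsing_inv _ hu
    have hcs (A : Matrix n n k) : scalar n c * A = A * scalar n c :=
      scalar_commute c (fun _ ↦ Commute.all _ _) A
    set p := scalar n c + s with hp
    set q := scalar n c - s with hq
    have hpq : p * q = q * p := by
      simp only [hp, hq, mul_add, add_mul, mul_sub, sub_mul, hcs s]; abel
    have hqJ : qᵀ * J = J * p := by
      rw [hp, hq, transpose_sub, sub_mul, hs, mul_add, ← hcs]
      simp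
    have hpJ : pᵀ * J = J * q := by
      rw [hp, hq, transpose_add, add_mul, hs, mul_sub, ← hcs]
      simp [sub_eq_add_neg]
    have hpT : p * T = T * p := by rw [hp, add_mul, mul_add, hsT, hcs]
    have hqT : q * T = T * q := by rw [hq, sub_mul, mul_sub, hsT, hcs]
    have hpiT : p⁻¹ * T = T * p⁻¹ := by
      calc p⁻¹ * T = p⁻¹ * (T * p) * p⁻¹ := by rw [mul_assoc, mul_assoc, h1', mul_one]
        _ = T * p⁻¹ := by rw [← hpT, ← mul_assoc, h1, one_mul]
    constructor
    · have h3 : (p⁻¹)ᵀ * pᵀ = 1 := by rw [← transpose_mul, h1', transpose_one]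
      change (q * p⁻¹)ᵀ * J * (q * p⁻¹) = J
      calc (q * p⁻¹)ᵀ * J * (q * p⁻¹) = (p⁻¹)ᵀ * (qᵀ * J) * (q * p⁻¹) := by
            rw [transpose_mul]; simp only [mul_assoc]
        _ = (p⁻¹)ᵀ * J * (p * q) * p⁻¹ := by rw [hqJ]; simp only [mul_assoc]
        _ = (p⁻¹)ᵀ * (J * q) * (p * p⁻¹) := by rw [hpq]; simp only [mul_assoc]
        _ = J := by rw [← hpJ, h1', mul_one, ← mul_assoc, h3, one_mul]
    · change q * p⁻¹ * T = T * (q * p⁻¹)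
      rw [mul_assoc, hpiT, ← mul_assoc, hqT, mul_assoc]

section Endomorphism

open Polynomial LinearMap

variable {k V : Type*} [Field k] [AddCommGroup V] [Module k V] [Module.Finite k V]

theorem exists_aeval_eq_of_commute_of_natDegree_minpoly {f g : Module.End k V}
    (hf : (minpoly k f).natDegree = Module.finrank k V) (hg : Commute g f) :
    ∃ p : k[X], g = aeval f p := by
  obtain ⟨v, hv⟩ := Module.exists_ker_toSpanSingleton_eq_annihilator k[X] (Module.AEval' f)
  rw [← span_minpoly_eq_annihilator] at hv
  have htop : (range (toSpanSingleton k[X] _ v)).restrictScalars k = ⊤ := by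
    apply Submodule.eq_top_of_finrank_eq
    rw [← (Module.AEval'.of f).finrank_eq, ← hf]
    exact finrank_range_toSpanSingleton_eq_natDegree hv
  have hgen (u : V) : ∃ q : k[X], u = aeval f q ((Module.AEval'.of f).symm v) := by
    obtain ⟨q, hq⟩ : Module.AEval'.of f u ∈
      (range (toSpanSingleton k[X] _ v)).restrictScalars k := htop ▸ Submodule.mem_top
    exact ⟨q, by simpa using congr_arg (Module.AEval'.of f).symm hq.symm⟩
  obtain ⟨p, hp⟩ := hgen (g ((Module.AEval'.of f).symm v))
  refine ⟨p, LinearMap.ext fun u ↦ ?_⟩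
  obtain ⟨q, rfl⟩ := hgen u
  have hq : Commute g (aeval f q) := Algebra.commute_of_mem_adjoin_singleton_of_commute
    (aeval_mem_adjoin_singleton k f) hg
  rw [← Module.End.mul_apply, hq.eq, Module.End.mul_apply, hp, ← Module.End.mul_apply,
    ← Module.End.mul_apply, ← map_mul, ← map_mul, mul_comm]

theorem natDegree_minpoly_eq_finrank_of_commute {f : Module.End k V}
    (hf : ∀ g h : Module.End k V, Commute g f → Commute h f → Commute g h) :
    (minpoly k f).natDegree = Module.finrank k V := by
  obtain ⟨v, hv⟩ := Module.exists_ker_toSpanSingleton_eq_annihilator k[X] (Module.AEval' f)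
  have hann := (span_minpoly_eq_annihilator k f).symm
  rw [hann] at hv
  have hfin : Module.Finite k (Module.AEval' f) := inferInstance
  have hcomm (φ ψ : Module.End k[X] (Module.AEval' f)) : Commute φ ψ := by
    let r (φ : Module.End k[X] (Module.AEval' f)) : Module.End k V :=
      (Module.AEval'.of f).symm ∘ₗ φ.restrictScalars k ∘ₗ (Module.AEval'.of f).toLinearMap
    have hr (φ) : Commute (r φ) f := LinearMap.ext fun u ↦ by
      simp [r, ← Module.AEval'.X_smul_of]
    refine LinearMap.ext fun u ↦ ?_
    have := LinearMap.congr_fun (hf _ _ (hr φ) (hr ψ)) ((Module.AEval'.of f).symm u)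
    simpa [r] using this
  have htop := range_toSpanSingleton_eq_top_of_commute
    (minpoly.monic (Algebra.IsIntegral.isIntegral f)) hann hv hcomm
  rw [← finrank_range_toSpanSingleton_eq_natDegree hv, (Module.AEval'.of f).finrank_eq, htop]
  exact (Submodule.topEquiv.restrictScalars k).finrank_eq

end Endomorphism

namespace Matrix

open Polynomial

variable {k n : Type*} [Field k] [Fintype n] [DecidableEq n] {T : Matrix n n k}

theorem minpoly_eq_charpoly_iff_natDegree :
    minpoly k T = T.charpoly ↔
      (minpoly k T.toLin').natDegree = Module.finrank k (n → k) := by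
  rw [minpoly_toLin', Module.finrank_fintype_fun_eq_card, ← T.charpoly_natDegree_eq_dim]
  refine ⟨fun h ↦ by rw [h], fun h ↦ ?_⟩
  exact (Polynomial.eq_of_monic_of_dvd_of_natDegree_le
    (minpoly.monic (Algebra.IsIntegral.isIntegral T)) T.charpoly_monic
    (minpoly_dvd_charpoly T) h.ge).symm

theorem exists_aeval_eq_of_commute {g : Matrix n n k} (hT : minpoly k T = T.charpoly)
    (hg : Commute g T) : ∃ p : k[X], g = aeval T p := by
  let e : Matrix n n k ≃ₐ[k] Module.End k (n → k) := toLinAlgEquiv'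
  have hg' : Commute (e g) (e T) := hg.map e
  have hdeg : (minpoly k (e T)).natDegree = Module.finrank k (n → k) :=
    minpoly_eq_charpoly_iff_natDegree.mp hT
  obtain ⟨p, hp⟩ := exists_aeval_eq_of_commute_of_natDegree_minpoly hdeg hg'
  rw [aeval_algHom_apply e T p] at hp
  exact ⟨p, e.injective hp⟩

theorem minpoly_eq_charpoly_of_commute
    (hT : ∀ g h : Matrix n n k, Commute g T → Commute h T → Commute g h) :
    minpoly k T = T.charpoly := by
  refine minpoly_eq_charpoly_iff_natDegree.mpr (natDegree_minpoly_eq_finrank_of_commute ?_)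
  intro g h hg hh
  have e (x : Module.End k (n → k)) (hx : Commute x T.toLin') :
      Commute (toLinAlgEquiv'.symm x) T := by
    have hx' := hx.map (toLinAlgEquiv' : Matrix n n k ≃ₐ[k] _).symm
    rwa [show T.toLin' = toLinAlgEquiv' T from rfl, AlgEquiv.symm_apply_apply] at hx'
  simpa using (hT _ _ (e g hg) (e h hh)).map toLinAlgEquiv'

theorem transpose_aeval_mul {J : Matrix n n k} (hT : Tᵀ * J = J * T) (p : k[X]) :
    (aeval T p)ᵀ * J = J * aeval T p := by
  induction p using Polynomial.induction_on' with
  | add p q hp hq => simp [add_mul, mul_add, hp, hq]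
  | monomial i a =>
    have h : SemiconjBy J T Tᵀ := hT.symm
    rw [aeval_monomial, ← Algebra.smul_def, transpose_smul, transpose_pow, smul_mul_assoc,
      mul_smul_comm, (h.pow_right i).eq]

theorem finite_isometry_commute_of_minpoly_eq_charpoly (h2 : (2 : k) ≠ 0) {J : Matrix n n k}
    (hJ : IsUnit J) (hTJ : Tᵀ * J = J * T) (hT : minpoly k T = T.charpoly) :
    {g : Matrix n n k | gᵀ * J * g = J ∧ g * T = T * g}.Finite := by
  have hmonic : (minpoly k T).Monic := minpoly.monic (Algebra.IsIntegral.isIntegral T)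
  have : Module.Finite k (AdjoinRoot (minpoly k T)) := hmonic.finite_adjoinRoot
  have : IsArtinianRing (AdjoinRoot (minpoly k T)) := IsArtinianRing.of_finite k _
  have hu : IsUnit (2 : AdjoinRoot (minpoly k T)) := by
    have h := (IsUnit.mk0 _ h2).map (algebraMap k (AdjoinRoot (minpoly k T)))
    rwa [map_ofNat] at h
  refine ((finite_setOf_mul_self_eq_one hu).image
    fun x ↦ aeval T (AdjoinRoot.modByMonicHom hmonic x)).subset ?_
  rintro g ⟨hgJ, hgT⟩
  obtain ⟨p, rfl⟩ := exists_aeval_eq_of_commute hT hgT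
  rw [transpose_aeval_mul hTJ, mul_assoc] at hgJ
  have hsq : aeval T p * aeval T p = 1 := hJ.mul_left_cancel (hgJ.trans (mul_one J).symm)
  refine ⟨AdjoinRoot.mk _ p, ?_, ?_⟩
  · change AdjoinRoot.mk _ p * AdjoinRoot.mk _ p = 1
    rw [← map_mul, ← map_one (AdjoinRoot.mk (minpoly k T)), AdjoinRoot.mk_eq_mk]
    exact minpoly.dvd k T (by simp [hsq])
  · change aeval T (AdjoinRoot.modByMonicHom hmonic (AdjoinRoot.mk _ p)) = aeval T p
    rw [AdjoinRoot.modByMonicHom_mk]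
    exact minpoly.aeval_modByMonic_minpoly p T

theorem minpoly_eq_charpoly_of_finite_isometry_commute [Infinite k] (h2 : (2 : k) ≠ 0)
    {J : Matrix n n k} (hJsymm : Jᵀ = J) (hJ : IsUnit J) (hTJ : Tᵀ * J = J * T)
    (hfin : {g : Matrix n n k | gᵀ * J * g = J ∧ g * T = T * g}.Finite) :
    minpoly k T = T.charpoly := by
  have hJ' : IsUnit J.det := (isUnit_iff_isUnit_det J).mp hJ
  have hJ1 := mul_nonsing_inv J hJ'
  have hJ2 := nonsing_inv_mul J hJ'
  have hself (a : Matrix n n k) (ha : Commute a T) : aᵀ * J = J * a := by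
    by_contra hne
    refine infinite_isometry_commute_of_skew h2 (J := J) (T := T) (s := a - J⁻¹ * aᵀ * J)
      ?_ ?_ ?_ hfin
    · rw [transpose_sub, transpose_mul, transpose_mul, transpose_transpose, transpose_nonsing_inv,
        hJsymm, sub_mul, mul_sub, mul_assoc J, mul_assoc a, hJ2, mul_one, mul_assoc J⁻¹,
        ← mul_assoc J J⁻¹, hJ1, one_mul, neg_sub]
    · have haT : aᵀ * Tᵀ = Tᵀ * aᵀ := by rw [← transpose_mul, ← transpose_mul, ha.eq]
      have hJT : J⁻¹ * Tᵀ = T * J⁻¹ := by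
        calc J⁻¹ * Tᵀ = J⁻¹ * (Tᵀ * J) * J⁻¹ := by rw [mul_assoc, mul_assoc, hJ1, mul_one]
          _ = T * J⁻¹ := by rw [hTJ, ← mul_assoc, hJ2, one_mul]
      rw [sub_mul, mul_sub, ha.eq, mul_assoc _ J, ← hTJ, mul_assoc J⁻¹, ← mul_assoc aᵀ, haT,
        mul_assoc Tᵀ, ← mul_assoc J⁻¹, hJT]
      simp only [mul_assoc]
    · intro h0
      apply hne
      rw [sub_eq_zero.mp h0, mul_assoc J⁻¹, ← mul_assoc J J⁻¹, hJ1, one_mul,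
        ← mul_assoc, ← sub_eq_zero.mp h0]
  refine minpoly_eq_charpoly_of_commute fun g h hg hh ↦ hJ.mul_left_cancel ?_
  rw [← hself _ (hg.mul_left hh), transpose_mul, mul_assoc, hself g hg, ← mul_assoc, hself h hh,
    mul_assoc]

end Matrix

open Matrix

/-- **Regularity criterion via finiteness of the orthogonal stabilizer.**
Let `k` be an infinite field of characteristic `≠ 2`, `m ≥ 1`, `J` a symmetric
invertible `m × m` matrix over `k`, and `T` a self-adjoint matrix
(`J⁻¹ * Tᵀ * J = T`). Then the stabilizer
`{g | gᵀ * J * g = J ∧ g * T = T * g}` of `T` in `O(J)(k)` is finite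
if and only if the minimal polynomial of `T` equals its characteristic
polynomial. -/
theorem stabilizer_finite_iff_regular
    (k : Type) [Field k] [Infinite k] (hk : ringChar k ≠ 2)
    (m : ℕ) (hm : 1 ≤ m)
    (J : Matrix (Fin m) (Fin m) k) (hJsymm : Jᵀ = J) (hJ : IsUnit J)
    (T : Matrix (Fin m) (Fin m) k) (hT : J⁻¹ * Tᵀ * J = T) :
    ({g : Matrix (Fin m) (Fin m) k | gᵀ * J * g = J ∧ g * T = T * g}).Finite
      ↔ minpoly k T = T.charpoly := by
  have h2 : (2 : k) ≠ 0 := Ring.two_ne_zero hk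
  have hTJ : Tᵀ * J = J * T := by
    have hJ1 := mul_nonsing_inv J ((isUnit_iff_isUnit_det J).mp hJ)
    conv_rhs => rw [← hT, mul_assoc J⁻¹, ← mul_assoc, hJ1, one_mul]
  exact ⟨minpoly_eq_charpoly_of_finite_isometry_commute h2 hJsymm hJ hTJ,
    finite_isometry_commute_of_minpoly_eq_charpoly h2 hJ hTJ⟩
end

section
/- Let n ≥ 1, let k be a field with char(k) ≠ 2, set m = 2n + 2, and let J ∈ GL_m(k) be the anti-diagonal matrix with J_{i,j} = 1 if i + j = m + 1 and 0 otherwise. Then for every tuple (c_2, c_3, …, c_{2n+2}) ∈ k^{2n+1} there exists a matrix T ∈ M_m(k) such that: (i) T is self-adjoint with respect to J, i.e., J Tᵀ J = T; (ii) trace(T) = 0; (iii) T_{i,j} = 0 whenever i > j + 1 and T_{j+1,j} = 1 for all 1 ≤ j ≤ m − 1; and (iv) the characteristic polynomial of T is x^{2n+2} + c_2 x^{2n} + ⋯ + c_{2n+1} x + c_{2n+2}. In particular the minimal polynomial of T equals its characteristic polynomial. -/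
open Matrix Polynomial

/-- The anti-diagonal Gram matrix of the split symmetric bilinear form:
(in 1-indexed terms) `J i j = 1` if `i + j = m + 1` and `0` otherwise. -/
def antidiagJ (k : Type) [Field k] (m : ℕ) : Matrix (Fin m) (Fin m) k :=
  Matrix.of fun i j => if (i : ℕ) + (j : ℕ) + 1 = m then 1 else 0

/-- The coefficients of the power series square root, with constant term `1`, of a power series
with coefficients `c` and constant term `1`. -/
def sqrtCoeff {k : Type} [Field k] (c : ℕ → k) : ℕ → k
  | 0 => 1
  | s + 1 => (c (s + 1) - ∑ i : Fin s, sqrtCoeff c (i + 1) * sqrtCoeff c (s - i)) / 2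

lemma sum_antidiagonal_sqrtCoeff {k : Type} [Field k] (h2 : (2 : k) ≠ 0) (c : ℕ → k)
    (h0 : c 0 = 1) (s : ℕ) :
    ∑ p ∈ Finset.HasAntidiagonal.antidiagonal s, sqrtCoeff c p.1 * sqrtCoeff c p.2 = c s := by
  cases s with
  | zero => simp [sqrtCoeff, h0]
  | succ s =>
    rw [Finset.Nat.sum_antidiagonal_eq_sum_range_succ (fun a b => sqrtCoeff c a * sqrtCoeff c b),
      Finset.sum_range_succ, Finset.sum_range_succ']
    have h : ∑ i ∈ Finset.range s, sqrtCoeff c (i + 1) * sqrtCoeff c (s + 1 - (i + 1))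
        = ∑ i : Fin s, sqrtCoeff c (i + 1) * sqrtCoeff c (s - i) := by
      rw [Finset.sum_range]
      simp
    have hs : 2 * sqrtCoeff c (s + 1)
        = c (s + 1) - ∑ i : Fin s, sqrtCoeff c (i + 1) * sqrtCoeff c (s - i) := by
      rw [sqrtCoeff]
      field_simp
    have h1 : sqrtCoeff c 0 = 1 := by rw [sqrtCoeff]
    simp only [h, Nat.sub_self, Nat.sub_zero, h1]
    linear_combination hs

/-- The polynomials `∑ a ≤ j, g a * X ^ (j - a)`, defined by Horner's scheme. -/
noncomputable def hornerPoly {k : Type} [Field k] (g : ℕ → k) : ℕ → k[X]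
  | 0 => C (g 0)
  | j + 1 => X * hornerPoly g j + C (g (j + 1))

lemma sum_antidiagonal_hornerPoly {k : Type} [Field k] (g : ℕ → k) (N : ℕ) :
    ∑ p ∈ Finset.HasAntidiagonal.antidiagonal N, C (g p.1) * hornerPoly g p.2
      = hornerPoly (fun s => ∑ p ∈ Finset.HasAntidiagonal.antidiagonal s, g p.1 * g p.2) N := by
  induction N with
  | zero => simp [hornerPoly]
  | succ N ih =>
    conv_rhs => rw [hornerPoly, ← ih, Finset.Nat.sum_antidiagonal_succ']
    rw [Finset.Nat.sum_antidiagonal_succ']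
    simp only [hornerPoly, mul_add, Finset.sum_add_distrib, Finset.mul_sum, map_add, map_sum,
      map_mul, mul_left_comm X]
    ring

lemma hornerPoly_eq_sum {k : Type} [Field k] (g : ℕ → k) (N : ℕ) :
    hornerPoly g N = ∑ s ∈ Finset.range (N + 1), C (g s) * X ^ (N - s) := by
  induction N with
  | zero => simp [hornerPoly]
  | succ N ih =>
    rw [hornerPoly, ih, Finset.sum_range_succ _ (N + 1), Finset.mul_sum]
    congr 1
    · refine Finset.sum_congr rfl fun s hs => ?_
      rw [Finset.mem_range] at hs
      rw [show N + 1 - s = N - s + 1 by omega, pow_succ]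
      ring
    · simp

/-- A Hessenberg matrix with unit subdiagonal, whose other nonzero entries lie in the first row
and the last column. -/
def rowColHessenberg {k : Type} [Field k] (g : ℕ → k) (N : ℕ) :
    Matrix (Fin (N + 1)) (Fin (N + 1)) k :=
  Matrix.of fun i j => (if (i : ℕ) = j + 1 then 1 else 0) - (if (i : ℕ) = 0 then g (j + 1) else 0)
    - (if (j : ℕ) = N then g (N + 1 - i) else 0)

lemma antidiagJ_mul_transpose_mul {k : Type} [Field k] (N : ℕ)
    (M : Matrix (Fin (N + 1)) (Fin (N + 1)) k) :
    antidiagJ k (N + 1) * Mᵀ * antidiagJ k (N + 1) = Matrix.of fun i j => M j.rev i.rev := by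
  have hJ (i j : Fin (N + 1)) : antidiagJ k (N + 1) i j = if j = i.rev then 1 else 0 := by
    simp only [antidiagJ, Matrix.of_apply, Fin.ext_iff, Fin.val_rev]
    congr 1
    rw [eq_iff_iff]
    omega
  have hJ' (i j : Fin (N + 1)) : antidiagJ k (N + 1) i j = if i = j.rev then 1 else 0 := by
    rw [hJ]
    exact if_congr ⟨fun h => by rw [h, Fin.rev_rev], fun h => by rw [h, Fin.rev_rev]⟩ rfl rfl
  ext i j
  rw [Matrix.mul_apply]
  simp only [hJ', mul_ite, mul_one, mul_zero, Finset.sum_ite_eq',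
    Finset.mem_univ, if_true]
  rw [Matrix.mul_apply]
  simp [hJ]

lemma rowColHessenberg_rev {k : Type} [Field k] (g : ℕ → k) (N : ℕ) (i j : Fin (N + 1)) :
    rowColHessenberg g N j.rev i.rev = rowColHessenberg g N i j := by
  have hi := i.isLt
  have hj := j.isLt
  simp only [rowColHessenberg, Matrix.of_apply, Fin.val_rev]
  rw [sub_right_comm]
  congr 1
  · congr 1
    · congr 1
      rw [eq_iff_iff]
      omega
    · rw [show N + 1 - (N + 1 - (j + 1 : ℕ)) = j + 1 by omega]
      congr 1
      rw [eq_iff_iff]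
      omega
  · rw [show N + 1 - (i + 1 : ℕ) + 1 = N + 1 - i by omega]
    congr 1
    rw [eq_iff_iff]
    omega

lemma rowColHessenberg_mulVec_single {k : Type} [Field k] (g : ℕ → k) (N : ℕ)
    (h0 : g 0 = 1) (j : ℕ) (hj : j < N + 1) :
    (aeval (rowColHessenberg g N) (hornerPoly g j)) *ᵥ Pi.single 0 1
      = Pi.single (⟨j, hj⟩ : Fin (N + 1)) 1 := by
  induction j with
  | zero =>
    rw [hornerPoly, h0, map_one, map_one, Matrix.one_mulVec]
    rfl
  | succ j ih =>
    have hjN : j ≠ N := by omega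
    rw [hornerPoly, map_add, map_mul, aeval_X, aeval_C, Matrix.add_mulVec, ← Matrix.mulVec_mulVec,
      ih (by omega), Algebra.algebraMap_eq_smul_one, Matrix.smul_mulVec, Matrix.one_mulVec]
    ext i
    simp only [rowColHessenberg, Matrix.mulVec_single_one, Pi.add_apply, Pi.smul_apply,
      Matrix.col_apply, Matrix.of_apply, Pi.single_apply, Fin.ext_iff, hjN, if_false]
    by_cases hi : (i : ℕ) = 0 <;> simp [hi]

lemma aeval_rowColHessenberg {k : Type} [Field k] (g : ℕ → k) (N : ℕ) (h0 : g 0 = 1) :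
    aeval (rowColHessenberg g N)
      (hornerPoly (fun s => ∑ p ∈ Finset.HasAntidiagonal.antidiagonal s, g p.1 * g p.2) (N + 1)) = 0 := by
  set f := hornerPoly (fun s => ∑ p ∈ Finset.HasAntidiagonal.antidiagonal s, g p.1 * g p.2) (N + 1) with hf
  have key : (aeval (rowColHessenberg g N) f) *ᵥ Pi.single 0 1 = 0 := by
    rw [hf, ← sum_antidiagonal_hornerPoly, Finset.Nat.sum_antidiagonal_succ, map_add, map_sum,
      Matrix.add_mulVec, Matrix.sum_mulVec]
    have hlow : ∀ p ∈ Finset.HasAntidiagonal.antidiagonal N,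
        (aeval (rowColHessenberg g N) (C (g (p.1 + 1)) * hornerPoly g p.2)) *ᵥ Pi.single 0 1
          = fun i : Fin (N + 1) => if p.2 = i then g (p.1 + 1) else 0 := by
      intro p hp
      rw [Finset.HasAntidiagonal.mem_antidiagonal] at hp
      rw [map_mul, aeval_C, ← Matrix.mulVec_mulVec,
        rowColHessenberg_mulVec_single g N h0 p.2 (by omega), Algebra.algebraMap_eq_smul_one,
        Matrix.smul_mulVec, Matrix.one_mulVec]
      ext i
      simp [Pi.single_apply, Fin.ext_iff, eq_comm]
    rw [Finset.sum_congr rfl hlow, h0, hornerPoly, map_one, one_mul, map_add, map_mul, aeval_X,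
      aeval_C, Matrix.add_mulVec, ← Matrix.mulVec_mulVec,
      rowColHessenberg_mulVec_single g N h0 N (by omega), Algebra.algebraMap_eq_smul_one,
      Matrix.smul_mulVec, Matrix.one_mulVec]
    ext i
    have hi := i.isLt
    have hsum : ∑ p ∈ Finset.HasAntidiagonal.antidiagonal N, (if p.2 = (i : ℕ) then g (p.1 + 1) else 0)
        = g (N + 1 - i) := by
      rw [Finset.sum_eq_single (N - (i : ℕ), (i : ℕ))]
      · rw [if_pos rfl, show N - (i : ℕ) + 1 = N + 1 - i by omega]
      · rintro ⟨a, b⟩ hp hne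
        rw [Finset.HasAntidiagonal.mem_antidiagonal] at hp
        refine if_neg fun hb => hne ?_
        simp only [Prod.mk.injEq] at hp hb ⊢
        omega
      · intro hp
        exact absurd (Finset.HasAntidiagonal.mem_antidiagonal.2 (by simp only; omega)) hp
    have hiN : (i : ℕ) ≠ N + 1 := by omega
    simp only [rowColHessenberg, Matrix.mulVec_single_one, Pi.add_apply, Pi.smul_apply,
      Matrix.col_apply, Matrix.of_apply, Pi.single_apply, Fin.ext_iff, Finset.sum_apply, hsum,
      hiN, if_false, if_true]
    rw [Fin.val_zero, Pi.zero_apply]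
    split_ifs <;> simp only [smul_eq_mul] <;> ring
  refine Matrix.ext_of_mulVec_single fun j => ?_
  rw [← rowColHessenberg_mulVec_single g N h0 j j.isLt, Matrix.mulVec_mulVec, ← map_mul, mul_comm,
    map_mul, ← Matrix.mulVec_mulVec, key, Matrix.mulVec_zero, Matrix.zero_mulVec]

lemma hessenberg_pow_apply_zero {k : Type} [Field k] (N : ℕ)
    (T : Matrix (Fin (N + 1)) (Fin (N + 1)) k)
    (hT : ∀ i j : Fin (N + 1), (j : ℕ) + 1 < i → T i j = 0)
    (hT1 : ∀ i j : Fin (N + 1), (i : ℕ) = j + 1 → T i j = 1) (d : ℕ) (i : Fin (N + 1))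
    (hi : d ≤ i) : (T ^ d) i 0 = if (i : ℕ) = d then 1 else 0 := by
  induction d generalizing i with
  | zero =>
    rw [pow_zero, Matrix.one_apply]
    exact if_congr Fin.ext_iff rfl rfl
  | succ d ih =>
    have hiN := i.isLt
    rw [pow_succ', Matrix.mul_apply, Finset.sum_eq_single (⟨d, by omega⟩ : Fin (N + 1))]
    · rw [ih _ le_rfl, if_pos rfl, mul_one]
      split_ifs with h
      · exact hT1 _ _ h
      · exact hT _ _ (by simp only; omega)
    · intro j _ hj
      rw [Ne, Fin.ext_iff] at hj
      rcases lt_or_ge (j : ℕ) d with h | h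
      · rw [hT i j (by omega), zero_mul]
      · rw [ih j h, if_neg hj, mul_zero]
    · simp

lemma le_natDegree_of_aeval_hessenberg_eq_zero {k : Type} [Field k] (N : ℕ)
    (T : Matrix (Fin (N + 1)) (Fin (N + 1)) k)
    (hT : ∀ i j : Fin (N + 1), (j : ℕ) + 1 < i → T i j = 0)
    (hT1 : ∀ i j : Fin (N + 1), (i : ℕ) = j + 1 → T i j = 1) (q : k[X]) (hq : q.Monic)
    (h : aeval T q = 0) : N + 1 ≤ q.natDegree := by
  by_contra! hlt
  rw [aeval_eq_sum_range] at h
  have hpow := hessenberg_pow_apply_zero N T hT hT1 q.natDegree ⟨q.natDegree, hlt⟩ le_rfl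
  have h' := congrFun (congrFun h ⟨q.natDegree, hlt⟩) 0
  simp only [Matrix.sum_apply, Matrix.smul_apply, smul_eq_mul, Matrix.zero_apply] at h'
  rw [Finset.sum_range_succ, Finset.sum_eq_zero, hpow, if_pos rfl, hq.coeff_natDegree] at h'
  · simp at h'
  · intro d hd
    rw [Finset.mem_range] at hd
    rw [hessenberg_pow_apply_zero N T hT hT1 _ _ hd.le, if_neg hd.ne', mul_zero]

lemma minpoly_eq_of_hessenberg {k : Type} [Field k] (N : ℕ)
    (T : Matrix (Fin (N + 1)) (Fin (N + 1)) k)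
    (hT : ∀ i j : Fin (N + 1), (j : ℕ) + 1 < i → T i j = 0)
    (hT1 : ∀ i j : Fin (N + 1), (i : ℕ) = j + 1 → T i j = 1) (p : k[X]) (hp : p.Monic)
    (hdeg : p.natDegree = N + 1) (h : aeval T p = 0) : p = minpoly k T := by
  refine minpoly.unique k T hp h fun q hq hq0 => ?_
  rw [degree_eq_natDegree hp.ne_zero, degree_eq_natDegree hq.ne_zero, hdeg]
  exact_mod_cast le_natDegree_of_aeval_hessenberg_eq_zero N T hT hT1 q hq hq0

lemma hornerPoly_natDegree {k : Type} [Field k] (g : ℕ → k) (h0 : g 0 = 1) (N : ℕ) :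
    (hornerPoly g N).Monic ∧ (hornerPoly g N).natDegree = N := by
  induction N with
  | zero => simp [hornerPoly, h0]
  | succ N ih =>
    have hX : (X * hornerPoly g N).Monic := monic_X.mul ih.1
    have hdeg : (X * hornerPoly g N).natDegree = N + 1 := by
      rw [monic_X.natDegree_mul ih.1, natDegree_X, ih.2, add_comm]
    refine ⟨hX.add_of_left ?_, ?_⟩
    · refine degree_C_le.trans_lt ?_
      rw [degree_eq_natDegree hX.ne_zero, hdeg]
      exact_mod_cast N.succ_pos
    · rw [hornerPoly, natDegree_add_C, hdeg]

/-- **Existence of the Kostant section `κ₁`.**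
Let `n ≥ 1`, `k` a field of characteristic `≠ 2`, `m = 2n + 2`, and `J` the
anti-diagonal matrix. For every tuple `(c_2, …, c_{2n+2})` there is a matrix
`T` that is (i) self-adjoint with respect to `J` (`J * Tᵀ * J = T`, using
`J = J⁻¹`), (ii) traceless, (iii) Hessenberg with unit subdiagonal, and (iv)
has characteristic polynomial `x^(2n+2) + c_2 x^(2n) + ⋯ + c_{2n+2}`; in
particular its minimal polynomial equals its characteristic polynomial. -/
theorem kostant_section_exists
    (n : ℕ) (hn : 1 ≤ n) (k : Type) [Field k] (hk : ringChar k ≠ 2)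
    (c : ℕ → k) :
    ∃ T : Matrix (Fin (2 * n + 2)) (Fin (2 * n + 2)) k,
      antidiagJ k (2 * n + 2) * Tᵀ * antidiagJ k (2 * n + 2) = T ∧
      Matrix.trace T = 0 ∧
      (∀ i j : Fin (2 * n + 2), (j : ℕ) + 1 < (i : ℕ) → T i j = 0) ∧
      (∀ i j : Fin (2 * n + 2), (i : ℕ) = (j : ℕ) + 1 → T i j = 1) ∧
      T.charpoly = X ^ (2 * n + 2)
        + ∑ i ∈ Finset.Icc 2 (2 * n + 2), C (c i) * X ^ (2 * n + 2 - i) ∧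
      minpoly k T = T.charpoly := by
  have h2 : (2 : k) ≠ 0 := Ring.two_ne_zero hk
  set c' : ℕ → k := fun s => if s = 0 then 1 else if s = 1 then 0 else c s with hc'
  set g := sqrtCoeff c' with hg
  have hg0 : g 0 = 1 := by rw [hg, sqrtCoeff]
  have hg1 : g 1 = 0 := by
    rw [hg, sqrtCoeff]
    simp [hc']
  have hconv : (fun s => ∑ p ∈ Finset.HasAntidiagonal.antidiagonal s, g p.1 * g p.2) = c' :=
    funext fun s => sum_antidiagonal_sqrtCoeff h2 c' (by simp [hc']) s
  have hpoly : hornerPoly c' (2 * n + 2) = X ^ (2 * n + 2)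
      + ∑ i ∈ Finset.Icc 2 (2 * n + 2), C (c i) * X ^ (2 * n + 2 - i) := by
    rw [hornerPoly_eq_sum, Finset.range_eq_Ico, Finset.sum_eq_sum_Ico_succ_bot (by omega),
      Finset.sum_eq_sum_Ico_succ_bot (by omega)]
    have hIco : Finset.Ico (0 + 1 + 1) (2 * n + 2 + 1) = Finset.Icc 2 (2 * n + 2) := by
      ext; simp only [Finset.mem_Ico, Finset.mem_Icc]; omega
    rw [hIco]
    simp only [hc', zero_add, one_ne_zero, if_true, if_false, map_one, map_zero, one_mul, zero_mul,
      Nat.sub_zero]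
    congr 1
    refine Finset.sum_congr rfl fun i hi => ?_
    rw [Finset.mem_Icc] at hi
    rw [if_neg (by omega), if_neg (by omega)]
  have hT : ∀ i j : Fin (2 * n + 1 + 1), (j : ℕ) + 1 < i →
      rowColHessenberg g (2 * n + 1) i j = 0 := by
    intro i j h
    have hi := i.isLt
    simp only [rowColHessenberg, Matrix.of_apply]
    rw [if_neg (by omega), if_neg (by omega), if_neg (by omega)]
    simp
  have hT1 : ∀ i j : Fin (2 * n + 1 + 1), (i : ℕ) = j + 1 →
      rowColHessenberg g (2 * n + 1) i j = 1 := by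
    intro i j h
    have hi := i.isLt
    simp only [rowColHessenberg, Matrix.of_apply]
    rw [if_pos h, if_neg (by omega), if_neg (by omega)]
    simp
  have hmin : hornerPoly c' (2 * n + 2) = minpoly k (rowColHessenberg g (2 * n + 1)) := by
    obtain ⟨hm, hd⟩ := hornerPoly_natDegree c' (by simp [hc']) (2 * n + 2)
    refine minpoly_eq_of_hessenberg _ _ hT hT1 _ hm hd ?_
    rw [← hconv]
    exact aeval_rowColHessenberg g (2 * n + 1) hg0
  have hchar : (rowColHessenberg g (2 * n + 1)).charpoly
      = minpoly k (rowColHessenberg g (2 * n + 1)) :=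
    minpoly_eq_of_hessenberg _ _ hT hT1 _ (Matrix.charpoly_monic _)
      (by rw [Matrix.charpoly_natDegree_eq_dim, Fintype.card_fin])
      (Matrix.aeval_self_charpoly _)
  refine ⟨rowColHessenberg g (2 * n + 1), ?_, ?_, hT, hT1, ?_, hchar.symm⟩
  · rw [antidiagJ_mul_transpose_mul]
    ext i j
    exact rowColHessenberg_rev g _ i j
  · refine Finset.sum_eq_zero fun i _ => ?_
    simp only [Matrix.diag_apply, rowColHessenberg, Matrix.of_apply]
    rw [if_neg (by omega)]
    have ha : (if (i : ℕ) = 0 then g (i + 1) else 0) = 0 := by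
      split_ifs with h
      · rw [h, zero_add, hg1]
      · rfl
    have hb : (if (i : ℕ) = 2 * n + 1 then g (2 * n + 1 + 1 - i) else 0) = 0 := by
      split_ifs with h
      · rw [h, Nat.add_sub_cancel_left, hg1]
      · rfl
    rw [ha, hb, sub_zero, sub_zero]
  · rw [hchar, ← hmin, hpoly]
end

section
/- Let n ≥ 1, let k be a field with char(k) ≠ 2, set m = 2n + 2, and let J ∈ GL_m(k) be the anti-diagonal matrix with J_{i,j} = 1 if i + j = m + 1 and 0 otherwise. Suppose T, T′ ∈ M_m(k) both satisfy: self-adjointness with respect to J (J Tᵀ J = T and J T′ᵀ J = T′), T_{i,j} = 0 and T′_{i,j} = 0 whenever i > j + 1, and T_{j+1,j} = T′_{j+1,j} = 1 for all 1 ≤ j ≤ m − 1. If T and T′ have the same characteristic polynomial, then there exists h ∈ M_m(k) with hᵀ J h = J and det h = 1 such that T′ = h T h⁻¹; that is, T and T′ are conjugate by an element of SO(J)(k). -/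
open Matrix

open Polynomial in
/-- A matrix annihilated by its characteristic polynomial takes the same value at `p` and at
the remainder of `p`. -/
theorem aeval_modByMonic_charpoly {R : Type*} [CommRing R] {ι : Type*} [Fintype ι]
    [DecidableEq ι] (T : Matrix ι ι R) (p : R[X]) :
    aeval T (p %ₘ T.charpoly) = aeval T p := by
  have h := congrArg (aeval T) (p.modByMonic_add_div T.charpoly)
  simpa [Matrix.aeval_self_charpoly] using h

open Polynomial in
/-- Powers of a matrix expressed through the powers below the dimension. -/
theorem pow_eq_sum_coeff_modByMonic {R : Type*} [CommRing R] [Nontrivial R] {m : ℕ}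
    (T : Matrix (Fin m) (Fin m) R) (l : ℕ) :
    T ^ l = ∑ i : Fin m, ((X ^ l : R[X]) %ₘ T.charpoly).coeff i • T ^ (i : ℕ) := by
  rcases Nat.eq_zero_or_pos m with rfl | hm
  · exact Subsingleton.elim _ _
  have hd : ((X ^ l : R[X]) %ₘ T.charpoly).natDegree < m := by
    have h1 : T.charpoly ≠ 1 := fun h => by
      have := T.charpoly_natDegree_eq_dim
      rw [h, natDegree_one, Fintype.card_fin] at this
      omega
    simpa [T.charpoly_natDegree_eq_dim] using
      natDegree_modByMonic_lt (X ^ l : R[X]) T.charpoly_monic h1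
  have h := aeval_modByMonic_charpoly T (X ^ l)
  rw [aeval_eq_sum_range' hd, map_pow, aeval_X] at h
  rw [← h, Finset.sum_range]

/-- Powers of a Hessenberg matrix with unit subdiagonal: the first column of `T ^ l` vanishes
below row `l`, where it is `1`. -/
theorem hessenberg_pow_apply_zero_s14 {R : Type*} [CommRing R] {N : ℕ}
    {T : Matrix (Fin (N + 1)) (Fin (N + 1)) R}
    (hbelow : ∀ i j : Fin (N + 1), (j : ℕ) + 1 < (i : ℕ) → T i j = 0)
    (hsub : ∀ i j : Fin (N + 1), (i : ℕ) = (j : ℕ) + 1 → T i j = 1) (l : ℕ) :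
    ∀ i : Fin (N + 1), (l < (i : ℕ) → (T ^ l) i 0 = 0) ∧ ((i : ℕ) = l → (T ^ l) i 0 = 1) := by
  induction l with
  | zero =>
    intro i
    refine ⟨fun h => ?_, fun h => ?_⟩
    · rw [pow_zero, one_apply_ne]
      rintro rfl
      simp at h
    · rw [Fin.ext (a := i) (b := 0) h, pow_zero, one_apply_eq]
  | succ l ih =>
    intro i
    simp only [pow_succ', mul_apply]
    refine ⟨fun h => Finset.sum_eq_zero fun j _ => ?_, fun h => ?_⟩
    · rcases lt_or_ge l (j : ℕ) with hj | hj
      · rw [(ih j).1 hj, mul_zero]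
      · rw [hbelow i j (by omega), zero_mul]
    · have hl : l < N + 1 := by omega
      rw [Finset.sum_eq_single (⟨l, hl⟩ : Fin (N + 1))]
      · rw [hsub i ⟨l, hl⟩ h, (ih ⟨l, hl⟩).2 rfl, mul_one]
      · intro j _ hj
        rcases lt_trichotomy l (j : ℕ) with h' | h' | h'
        · rw [(ih j).1 h', mul_zero]
        · exact absurd (Fin.ext h'.symm) hj
        · rw [hbelow i j (by omega), zero_mul]
      · simp

/-- The Krylov matrix of `T`, with columns `T ^ j` applied to the first basis vector. -/
def krylov {R : Type*} [CommRing R] {N : ℕ} (T : Matrix (Fin (N + 1)) (Fin (N + 1)) R) :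
    Matrix (Fin (N + 1)) (Fin (N + 1)) R :=
  Matrix.of fun i j => (T ^ (j : ℕ)) i 0

/-- The Krylov matrix of a Hessenberg matrix with unit subdiagonal is unitriangular. -/
theorem det_krylov {R : Type*} [CommRing R] {N : ℕ}
    {T : Matrix (Fin (N + 1)) (Fin (N + 1)) R}
    (hbelow : ∀ i j : Fin (N + 1), (j : ℕ) + 1 < (i : ℕ) → T i j = 0)
    (hsub : ∀ i j : Fin (N + 1), (i : ℕ) = (j : ℕ) + 1 → T i j = 1) :
    (krylov T).det = 1 := by
  rw [det_of_isUpperTriangular]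
  · exact Finset.prod_eq_one fun i _ => (hessenberg_pow_apply_zero_s14 hbelow hsub i i).2 rfl
  · intro i j hij
    exact (hessenberg_pow_apply_zero_s14 hbelow hsub j i).1 hij

open Polynomial in
/-- The matrix of multiplication by `X` on polynomials modulo `p` in the monomial basis. -/
noncomputable def mulXModMatrix {R : Type*} [CommRing R] (m : ℕ) (p : R[X]) :
    Matrix (Fin m) (Fin m) R :=
  Matrix.of fun i j => ((X ^ ((j : ℕ) + 1) : R[X]) %ₘ p).coeff i

theorem mul_krylov {R : Type*} [CommRing R] [Nontrivial R] {N : ℕ}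
    (T : Matrix (Fin (N + 1)) (Fin (N + 1)) R) :
    T * krylov T = krylov T * mulXModMatrix (N + 1) T.charpoly := by
  ext i j
  have h : (T * krylov T) i j = (T ^ ((j : ℕ) + 1)) i 0 := by
    rw [pow_succ']
    rfl
  rw [h, pow_eq_sum_coeff_modByMonic, Matrix.sum_apply, mul_apply]
  exact Finset.sum_congr rfl fun a _ => mul_comm _ _

/-- The lower-left entries of the powers of a Hessenberg matrix with unit subdiagonal depend
only on its characteristic polynomial. -/
theorem hessenberg_pow_last_zero {R : Type*} [CommRing R] [Nontrivial R] {N : ℕ}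
    {T : Matrix (Fin (N + 1)) (Fin (N + 1)) R}
    (hbelow : ∀ i j : Fin (N + 1), (j : ℕ) + 1 < (i : ℕ) → T i j = 0)
    (hsub : ∀ i j : Fin (N + 1), (i : ℕ) = (j : ℕ) + 1 → T i j = 1) (l : ℕ) :
    (T ^ l) (Fin.last N) 0 = ((Polynomial.X ^ l : Polynomial R) %ₘ T.charpoly).coeff N := by
  rw [pow_eq_sum_coeff_modByMonic, Matrix.sum_apply, Finset.sum_eq_single (Fin.last N)]
  · rw [Matrix.smul_apply, (hessenberg_pow_apply_zero_s14 hbelow hsub _ _).2 rfl, smul_eq_mul, mul_one,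
      Fin.val_last]
  · intro i _ hi
    have hlt : (i : ℕ) < ((Fin.last N : Fin (N + 1)) : ℕ) := Fin.lt_last_iff_ne_last.2 hi
    rw [Matrix.smul_apply, (hessenberg_pow_apply_zero_s14 hbelow hsub _ _).1 hlt, smul_zero]
  · simp

theorem antidiagJ_succ_apply (k : Type) [Field k] {N : ℕ} (i j : Fin (N + 1)) :
    antidiagJ k (N + 1) i j = if j = i.rev then 1 else 0 := by
  simp only [antidiagJ, of_apply, Fin.ext_iff, Fin.val_rev]
  exact if_congr (by omega) rfl rfl

theorem antidiagJ_mul_apply {k : Type} [Field k] {N : ℕ}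
    (M : Matrix (Fin (N + 1)) (Fin (N + 1)) k) (i j : Fin (N + 1)) :
    (antidiagJ k (N + 1) * M) i j = M i.rev j := by
  simp [mul_apply, antidiagJ_succ_apply]

theorem antidiagJ_mul_self (k : Type) [Field k] (N : ℕ) :
    antidiagJ k (N + 1) * antidiagJ k (N + 1) = 1 := by
  ext i j
  rw [antidiagJ_mul_apply, antidiagJ_succ_apply, Fin.rev_rev, one_apply]
  exact if_congr eq_comm rfl rfl

/-- The Gram matrix of the Krylov basis of a self-adjoint matrix is a Hankel matrix. -/
theorem gram_krylov_apply {k : Type} [Field k] {N : ℕ}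
    {T : Matrix (Fin (N + 1)) (Fin (N + 1)) k}
    (hT : antidiagJ k (N + 1) * Tᵀ * antidiagJ k (N + 1) = T) (i j : Fin (N + 1)) :
    ((krylov T)ᵀ * antidiagJ k (N + 1) * krylov T) i j =
      (T ^ ((i : ℕ) + (j : ℕ))) (Fin.last N) 0 := by
  have hJ : SemiconjBy (antidiagJ k (N + 1)) T Tᵀ := by
    have h := congrArg (antidiagJ k (N + 1) * ·) hT
    simp only [← mul_assoc, antidiagJ_mul_self, one_mul] at h
    exact h.symm
  have h : ((krylov T)ᵀ * antidiagJ k (N + 1) * krylov T) i j =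
      ((T ^ (i : ℕ))ᵀ * antidiagJ k (N + 1) * T ^ (j : ℕ)) 0 0 := rfl
  rw [h, transpose_pow, ← (hJ.pow_right (i : ℕ)).eq, mul_assoc, ← pow_add,
    antidiagJ_mul_apply, Fin.rev_zero]

/-- **Self-adjoint Hessenberg matrices with unit subdiagonal and equal
characteristic polynomial are `SO(J)`-conjugate** (sections of the indicated
shape factor through the Kostant section `κ₁`).
Let `n ≥ 1`, `k` a field of characteristic `≠ 2`, `m = 2n + 2`, and `J` the
anti-diagonal matrix. If `T`, `T'` are self-adjoint with respect to `J`
(`J * Mᵀ * J = M`, using `J = J⁻¹`), Hessenberg with unit subdiagonal, and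
have the same characteristic polynomial, then `T' = h * T * h⁻¹` for some
`h ∈ SO(J)(k)`, i.e. with `hᵀ * J * h = J` and `det h = 1`. -/
theorem hessenberg_selfadjoint_SO_conjugate
    (n : ℕ) (hn : 1 ≤ n) (k : Type) [Field k] (hk : ringChar k ≠ 2)
    (T T' : Matrix (Fin (2 * n + 2)) (Fin (2 * n + 2)) k)
    (hT : antidiagJ k (2 * n + 2) * Tᵀ * antidiagJ k (2 * n + 2) = T)
    (hT' : antidiagJ k (2 * n + 2) * T'ᵀ * antidiagJ k (2 * n + 2) = T')
    (hTbelow : ∀ i j : Fin (2 * n + 2), (j : ℕ) + 1 < (i : ℕ) → T i j = 0)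
    (hT'below : ∀ i j : Fin (2 * n + 2), (j : ℕ) + 1 < (i : ℕ) → T' i j = 0)
    (hTsub : ∀ i j : Fin (2 * n + 2), (i : ℕ) = (j : ℕ) + 1 → T i j = 1)
    (hT'sub : ∀ i j : Fin (2 * n + 2), (i : ℕ) = (j : ℕ) + 1 → T' i j = 1)
    (hcp : T.charpoly = T'.charpoly) :
    ∃ h : Matrix (Fin (2 * n + 2)) (Fin (2 * n + 2)) k,
      hᵀ * antidiagJ k (2 * n + 2) * h = antidiagJ k (2 * n + 2) ∧
      h.det = 1 ∧ T' = h * T * h⁻¹ := by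
  have hK := det_krylov hTbelow hTsub
  have hK' := det_krylov hT'below hT'sub
  have hu : IsUnit (krylov T).det := hK ▸ isUnit_one
  have hu' : IsUnit (krylov T').det := hK' ▸ isUnit_one
  have hgram : (krylov T')ᵀ * antidiagJ k (2 * n + 2) * krylov T' =
      (krylov T)ᵀ * antidiagJ k (2 * n + 2) * krylov T := by
    ext i j
    rw [gram_krylov_apply hT, gram_krylov_apply hT', hessenberg_pow_last_zero hTbelow hTsub,
      hessenberg_pow_last_zero hT'below hT'sub, hcp]
  have hC := mul_krylov T
  have hC' := mul_krylov T'
  rw [← hcp] at hC'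
  refine ⟨krylov T' * (krylov T)⁻¹, ?_, ?_, ?_⟩
  · calc (krylov T' * (krylov T)⁻¹)ᵀ * antidiagJ k (2 * n + 2) * (krylov T' * (krylov T)⁻¹)
        = (krylov T)⁻¹ᵀ * ((krylov T')ᵀ * antidiagJ k (2 * n + 2) * krylov T') *
            (krylov T)⁻¹ := by simp only [transpose_mul, mul_assoc]
      _ = (krylov T * (krylov T)⁻¹)ᵀ * antidiagJ k (2 * n + 2) *
            (krylov T * (krylov T)⁻¹) := by
          rw [hgram]
          simp only [transpose_mul, mul_assoc]
      _ = antidiagJ k (2 * n + 2) := by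
          rw [mul_nonsing_inv _ hu, transpose_one, one_mul, mul_one]
  · rw [det_mul, det_nonsing_inv, hK, hK', Ring.inverse_one, one_mul]
  · rw [Matrix.mul_inv_rev, nonsing_inv_nonsing_inv _ hu]
    calc T' = T' * krylov T' * (krylov T')⁻¹ := (mul_nonsing_inv_cancel_right _ _ hu').symm
      _ = krylov T' * ((krylov T)⁻¹ * (T * krylov T)) * (krylov T')⁻¹ := by
          rw [hC, hC', nonsing_inv_mul_cancel_left _ _ hu]
      _ = _ := by simp only [mul_assoc]
end

section
/- Let k be an algebraically closed field with char(k) ≠ 2 and let f ∈ k[x] be a monic polynomial of degree m ≥ 1 that is NOT the square of a polynomial in k[x]. Set L = k[x]/(f). Then there exists u ∈ L with u² = 1 and N_{L/k}(u) = −1, where N_{L/k}(u) denotes the determinant of the k-linear map L → L given by multiplication by u. -/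
open Polynomial in
theorem Polynomial.exists_odd_rootMultiplicity {k : Type*} [Field k] [IsAlgClosed k]
    {f : k[X]} (hf : f.Monic) (hnotsq : ¬ ∃ g : k[X], f = g ^ 2) :
    ∃ a, Odd (f.rootMultiplicity a) := by
  classical
  by_contra! h
  simp only [Nat.not_odd_iff_even] at h
  refine hnotsq ⟨∏ a ∈ f.roots.toFinset, (X - C a) ^ (f.rootMultiplicity a / 2), ?_⟩
  rw [← Finset.prod_pow]
  conv_lhs => rw [(IsAlgClosed.splits f).eq_prod_roots_of_monic hf]
  rw [Finset.prod_multiset_map_count]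
  refine Finset.prod_congr rfl fun a _ => ?_
  rw [count_roots, ← pow_mul, Nat.div_mul_cancel (h a).two_dvd]

theorem Algebra.norm_prod_mk {R A B : Type*} [CommRing R] [CommRing A] [CommRing B]
    [Algebra R A] [Algebra R B] [Module.Free R A] [Module.Finite R A]
    [Module.Free R B] [Module.Finite R B] (a : A) (b : B) :
    Algebra.norm R (a, b) = Algebra.norm R a * Algebra.norm R b := by
  simp only [Algebra.norm_apply]
  rw [← LinearMap.det_prodMap]
  rfl

open Polynomial in
theorem Polynomial.exists_sq_eq_one_norm_eq_neg_one_pow {k : Type*} [Field k] {p q : k[X]}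
    (hp : p ≠ 0) (hq : q ≠ 0) (hpq : IsCoprime p q) :
    ∃ u : k[X] ⧸ Ideal.span {p * q}, u ^ 2 = 1 ∧ Algebra.norm k u = (-1) ^ p.natDegree := by
  have hfin {r : k[X]} (hr : r ≠ 0) : Module.Finite k (k[X] ⧸ Ideal.span {r}) :=
    (AdjoinRoot.powerBasis hr).finite
  have := hfin hp
  have := hfin hq
  rw [← Ideal.span_singleton_mul_span_singleton]
  let e : (k[X] ⧸ Ideal.span {p} * Ideal.span {q}) ≃ₐ[k]
      (k[X] ⧸ Ideal.span {p}) × (k[X] ⧸ Ideal.span {q}) :=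
    AlgEquiv.ofRingEquiv (f := Ideal.quotientMulEquivQuotientProd _ _
      ((Ideal.isCoprime_span_singleton_iff p q).2 hpq)) fun _ => rfl
  refine ⟨e.symm (-1, 1), ?_, ?_⟩
  · have h : ((-1, 1) : (k[X] ⧸ Ideal.span {p}) × (k[X] ⧸ Ideal.span {q})) ^ 2 = 1 :=
      Prod.ext (neg_one_sq (R := k[X] ⧸ Ideal.span {p})) (one_pow 2)
    rw [← map_pow, h, map_one]
  · rw [Algebra.norm_eq_of_algEquiv, Algebra.norm_prod_mk, map_one, mul_one,
      ← finrank_quotient_span_eq_natDegree, ← Algebra.norm_algebraMap,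
      map_neg (algebraMap k (k[X] ⧸ Ideal.span {p})), map_one]

/-- **Existence of a square root of `1` of norm `-1`.**
Let `k` be an algebraically closed field of characteristic `≠ 2` and
`f ∈ k[x]` monic of degree `m ≥ 1`, not the square of a polynomial in `k[x]`.
Then in `L = k[x]/(f)` there is an element `u` with `u ^ 2 = 1` whose norm
`N_{L/k}(u)` (the determinant of multiplication by `u` on `L`) equals `-1`. -/
theorem exists_sqrt_one_norm_neg_one
    (k : Type) [Field k] [IsAlgClosed k] (hk : ringChar k ≠ 2)
    (f : Polynomial k) (hf : f.Monic) (hdeg : 1 ≤ f.natDegree)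
    (hnotsq : ¬ ∃ g : Polynomial k, f = g ^ 2) :
    ∃ u : Polynomial k ⧸ Ideal.span {f},
      u ^ 2 = 1 ∧ Algebra.norm k u = -1 := by
  obtain ⟨a, ha⟩ := Polynomial.exists_odd_rootMultiplicity hf hnotsq
  obtain ⟨q, hq, hndvd⟩ := Polynomial.exists_eq_pow_rootMultiplicity_mul_and_not_dvd f hf.ne_zero a
  have hcop : IsCoprime ((Polynomial.X - Polynomial.C a) ^ f.rootMultiplicity a) q :=
    ((Polynomial.irreducible_X_sub_C a).coprime_iff_not_dvd.2 hndvd).pow_left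
  have h := Polynomial.exists_sq_eq_one_norm_eq_neg_one_pow
    (pow_ne_zero _ (Polynomial.X_sub_C_ne_zero a))
    (right_ne_zero_of_mul (hq ▸ hf.ne_zero)) hcop
  rwa [Polynomial.natDegree_pow, Polynomial.natDegree_X_sub_C, mul_one, ha.neg_one_pow,
    ← hq] at h
end
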